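/- arXiv:2410.04432 — 3 statements merged into one kernel-verified Lean document; each statement's English description precedes it below -/
import Mathlib

section
/- The change of basis matrix L^{(q,α)} is totally positive (all minors nonnegative) if and only if α ≤ 0. -/
open Finset Matrix

noncomputable def qInt (q : ℝ) (m : ℕ) : ℝ := ∑ i ∈ Finset.range m, q ^ i

noncomputable def qFact (q : ℝ) (m : ℕ) : ℝ := ∏ i ∈ Finset.range m, qInt q (i + 1)

noncomputable def qBinom (q : ℝ) (m k : ℕ) : ℝ :=
  if k ≤ m then qFact q m / (qFact q k * qFact q (m - k)) else 0

noncomputable def Lmat (q α : ℝ) (n : ℕ) : Matrix (Fin (n + 1)) (Fin (n + 1)) ℝ :=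
  Matrix.of fun i j =>
    if j.1 = 0 then (if i.1 = 0 then 1 else 0)
    else if j.1 ≤ i.1 then
      (-α * qInt q i.1) ^ (i.1 - j.1) * q ^ (j.1.choose 2) * qBinom q (i.1 - 1) (i.1 - j.1)
    else 0

def IsTotallyPos {n : ℕ} (A : Matrix (Fin n) (Fin n) ℝ) : Prop :=
  ∀ (k : ℕ) (f g : Fin k → Fin n), StrictMono f → StrictMono g →
    0 ≤ (A.submatrix f g).det

def IsStrictTotallyPos {n : ℕ} (A : Matrix (Fin n) (Fin n) ℝ) : Prop :=
  ∀ (k : ℕ) (f g : Fin k → Fin n), StrictMono f → StrictMono g →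
    0 < (A.submatrix f g).det

namespace LTP

/-- Minors of an infinite matrix using only rows below `R` are nonnegative. -/
def TP (R : ℕ) (A : ℕ → ℕ → ℝ) : Prop :=
  ∀ (k : ℕ) (f g : Fin k → ℕ), StrictMono f → StrictMono g → (∀ a, f a < R) →
    0 ≤ (Matrix.of fun a b => A (f a) (g b)).det

theorem TP.congr {R : ℕ} {A B : ℕ → ℕ → ℝ} (h : TP R A) (hAB : ∀ i j, i < R → A i j = B i j) :
    TP R B := by
  intro k f g hf hg hR
  have := h k f g hf hg hR
  convert this using 3
  ext a b
  exact (hAB _ _ (hR a)).symm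

theorem TP.scale {R : ℕ} {A : ℕ → ℕ → ℝ} (h : TP R A) (u v : ℕ → ℝ)
    (hu : ∀ i, 0 ≤ u i) (hv : ∀ i, 0 ≤ v i) : TP R (fun i j => u i * (v j * A i j)) := by
  intro k f g hf hg hR
  have h1 := h k f g hf hg hR
  have e := Matrix.det_mul_column (fun a => u (f a))
    (Matrix.of fun a b => v (g b) * (Matrix.of fun a b => A (f a) (g b)) a b)
  have e2 := Matrix.det_mul_row (fun a => v (g a)) (Matrix.of fun a b => A (f a) (g b))
  rw [e2] at e
  have : 0 ≤ (∏ i, u (f i)) * ((∏ i, v (g i)) * (Matrix.of fun a b => A (f a) (g b)).det) :=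
    mul_nonneg (Finset.prod_nonneg fun _ _ => hu _)
      (mul_nonneg (Finset.prod_nonneg fun _ _ => hv _) h1)
  rw [← e] at this
  exact this

theorem TP_id (R : ℕ) : TP R (fun i j => if i = j then 1 else 0) := by
  intro k f g hf hg _
  by_cases h : Set.range f ⊆ Set.range g
  · have hc : Set.range f = Set.range g := by
      apply Set.eq_of_subset_of_ncard_le h
      rw [← Set.image_univ, ← Set.image_univ, Set.ncard_image_of_injective _ hf.injective,
        Set.ncard_image_of_injective _ hg.injective]
    have hfg : f = g := (StrictMono.range_inj hf hg).1 hc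
    subst hfg
    have : (Matrix.of fun a b => if f a = f b then (1 : ℝ) else 0) = (1 : Matrix (Fin k) (Fin k) ℝ) := by
      ext a b
      simp [Matrix.one_apply, hf.injective.eq_iff]
    rw [this]; simp
  · rw [Set.not_subset] at h
    obtain ⟨x, ⟨a, rfl⟩, hx⟩ := h
    rw [Matrix.det_eq_zero_of_row_eq_zero a]
    intro b
    simp only [Matrix.of_apply]
    rw [if_neg]
    intro h
    exact hx ⟨b, h.symm⟩

theorem TP.step {R : ℕ} {A B : ℕ → ℕ → ℝ} (h : TP R A) (r : ℕ) (d : ℝ) (hd : 0 ≤ d)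
    (h1 : ∀ i j, i ≠ r + 1 → B i j = A i j)
    (h2 : ∀ j, B (r + 1) j = A r j + d * A (r + 1) j) : TP R B := by
  intro k f g hf hg hR
  by_cases hr : ∃ p, f p = r + 1
  · obtain ⟨p, hp⟩ := hr
    set M : Matrix (Fin k) (Fin k) ℝ := Matrix.of fun a b => A (f a) (g b) with hM
    have e : (Matrix.of fun a b => B (f a) (g b)) =
        M.updateRow p ((fun b => A r (g b)) + d • (fun b => A (r + 1) (g b))) := by
      ext a b
      by_cases ha : a = p
      · subst ha
        simp [hp, h2]
      · have : f a ≠ r + 1 := fun h => ha (hf.injective (h.trans hp.symm))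
        simp [Matrix.updateRow_ne ha, h1 _ _ this, hM]
    have e2 : M.updateRow p (fun b => A (r + 1) (g b)) = M := by
      ext a b
      by_cases ha : a = p
      · subst ha
        simp [hp, hM]
      · simp [Matrix.updateRow_ne ha]
    rw [e, Matrix.det_updateRow_add, Matrix.det_updateRow_smul, e2]
    have hMn : 0 ≤ M.det := h k f g hf hg hR
    refine add_nonneg ?_ (mul_nonneg hd hMn)
    by_cases hs : ∃ s, f s = r
    · obtain ⟨s, hs⟩ := hs
      have hsp : p ≠ s := by rintro rfl; omega
      rw [Matrix.det_zero_of_row_eq hsp]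
      ext b
      simp [Matrix.updateRow_ne hsp.symm, hM, hs]
    · push Not at hs
      have hf' : StrictMono (Function.update f p r) := by
        intro a b hab
        have hab' := hf hab
        have hsa := hs a
        have hsb := hs b
        by_cases ha : a = p
        · have hb : b ≠ p := by rintro rfl; exact absurd ha hab.ne
          subst ha
          simp [Function.update_of_ne hb]; omega
        · by_cases hb : b = p
          · subst hb
            simp [Function.update_of_ne ha]; omega
          · simpa [Function.update_of_ne ha, Function.update_of_ne hb] using hab'
      have := h k _ g hf' hg (by
        intro a
        by_cases ha : a = p
        · subst ha
          have := hR a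
          simp; omega
        · simpa [Function.update_of_ne ha] using hR a)
      have e3 : (M.updateRow p fun b => A r (g b)) =
          Matrix.of fun a b => A (Function.update f p r a) (g b) := by
       ext a b
       by_cases ha : a = p
       · subst ha
         simp
       · simp [Matrix.updateRow_ne ha, Function.update_of_ne ha, hM]
      rw [e3]
      exact this
  · push Not at hr
    have := h k f g hf hg hR
    convert this using 3
    ext a b
    exact h1 _ _ (hr a)

/-- Divided difference of the `j`-th Newton polynomial at `t b, …, t (b+m)`. -/
def G (t : ℕ → ℝ) : ℕ → ℕ → ℕ → ℝ
  | 0, m, _ => if m = 0 then 1 else 0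
  | j + 1, 0, b => (t b - t j) * G t j 0 b
  | j + 1, m + 1, b => (t (b + m + 1) - t j) * G t j (m + 1) b + G t j m b

theorem G_zero (t : ℕ → ℝ) (j : ℕ) : ∀ m, G t j m 0 = if m = j then 1 else 0 := by
  induction j with
  | zero => intro m; simp [G]
  | succ j ih =>
    intro m
    cases m with
    | zero =>
      simp only [G, ih]
      by_cases h : 0 = j
      · subst h; simp
      · simp [h]
    | succ m =>
      simp only [G, ih]
      by_cases h : m + 1 = j
      · subst h; simp
      · simp [h]

theorem G_rec (t : ℕ → ℝ) (j : ℕ) : ∀ m b,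
    G t j m (b + 1) = G t j m b + (t (b + m + 1) - t b) * G t j (m + 1) b := by
  induction j with
  | zero => intro m b; simp [G]
  | succ j ih =>
    intro m b
    cases m with
    | zero =>
      have := ih 0 b
      simp only [G, this, add_zero]
      ring
    | succ m =>
      have h1 := ih (m + 1) b
      have h2 := ih m b
      simp only [G, h1, h2]
      have e1 : b + 1 + m + 1 = b + m + 1 + 1 := by ring
      have e2 : b + (m + 1) + 1 = b + m + 1 + 1 := by ring
      rw [e1, e2]
      ring

theorem G_prod (t : ℕ → ℝ) (j b : ℕ) : G t j 0 b = ∏ s ∈ Finset.range j, (t b - t s) := by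
  induction j with
  | zero => simp [G]
  | succ j ih => rw [Finset.prod_range_succ, ← ih, G, mul_comm]

/-- Partially eliminated matrix, bordered by a unit. -/
def H (t : ℕ → ℝ) (m : ℕ) : ℕ → ℕ → ℝ
  | 0, 0 => 1
  | 0, _ + 1 => 0
  | _ + 1, 0 => 0
  | i + 1, j + 1 => G t j (min m i) (i - m)

theorem H_id (t : ℕ → ℝ) (m i j : ℕ) (h : i < m) : H t m i j = if i = j then 1 else 0 := by
  cases i with
  | zero => cases j <;> simp [H]
  | succ i =>
    cases j with
    | zero => simp [H]
    | succ j =>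
      have e : i - m = 0 := by omega
      have e2 : min m i = i := by omega
      simp [H, e, e2, G_zero]

theorem H_TP_aux (t : ℕ → ℝ) (ht : Monotone t) (R m : ℕ) (h : TP R (H t (m + 1))) (r : ℕ) :
    TP R (fun i j => if i < r then H t m i j else H t (m + 1) i j) := by
  induction r with
  | zero => simpa using h
  | succ r ih =>
    by_cases hr : r ≤ m + 1
    · refine ih.congr ?_
      intro i j _
      by_cases hi : i = r
      · subst hi
        simp only [lt_irrefl, if_false, Nat.lt_succ_self, if_true]
        cases i with
        | zero => cases j <;> simp [H]
        | succ i =>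
          cases j with
          | zero => simp [H]
          | succ j =>
            have e1 : i - m = 0 := by omega
            have e2 : i - (m + 1) = 0 := by omega
            have e3 : min m i = i := by omega
            have e4 : min (m + 1) i = i := by omega
            simp [H, e1, e2, e3, e4]
      · by_cases hi2 : i < r
        · simp [hi2, Nat.lt_succ_of_lt hi2]
        · have : ¬ i < r + 1 := by omega
          simp [hi2, this]
    · obtain ⟨b, rfl⟩ : ∃ b, r = b + m + 1 + 1 := ⟨r - m - 2, by omega⟩
      refine ih.step (b + m + 1) (t (b + m + 1) - t b) (sub_nonneg.2 (ht (by omega))) ?_ ?_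
      · intro i j hi
        by_cases hi2 : i < b + m + 1 + 1
        · simp [hi2, Nat.lt_succ_of_lt hi2]
        · have : ¬ i < b + m + 1 + 1 + 1 := by omega
          simp [hi2, this]
      · intro j
        cases j with
        | zero => simp [H]
        | succ j =>
          have e1 : b + m + 1 - m = b + 1 := by omega
          have e2 : b + m + 1 - (m + 1) = b := by omega
          have e3 : min m (b + m + 1) = m := by omega
          have e4 : min (m + 1) (b + m + 1) = m + 1 := by omega
          have e5 : b + m - m = b := by omega
          have e6 : min m (b + m) = m := by omega
          simp only [lt_irrefl, if_false, Nat.lt_succ_self, if_true, H, e1, e2, e3, e4, e5, e6]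
          exact G_rec t j m b

theorem H_TP (t : ℕ → ℝ) (ht : Monotone t) (R : ℕ) : TP R (H t 0) := by
  have key : ∀ c m, m + c = R → TP R (H t m) := by
    intro c
    induction c with
    | zero =>
      intro m hm
      refine (TP_id R).congr ?_
      intro i j hi
      rw [H_id t m i j (by omega)]
    | succ c ih =>
      intro m hm
      refine (H_TP_aux t ht R m (ih (m + 1) (by omega)) R).congr ?_
      intro i j hi
      simp [hi]
  exact key R 0 (by omega)

theorem qInt_pos {q : ℝ} (hq : 0 < q) (m : ℕ) : 0 < qInt q (m + 1) := by
  unfold qInt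
  exact Finset.sum_pos (fun i _ => pow_pos hq i) ⟨0, by simp⟩

theorem qFact_pos {q : ℝ} (hq : 0 < q) (m : ℕ) : 0 < qFact q m :=
  Finset.prod_pos fun _ _ => qInt_pos hq _

theorem qInt_add (q : ℝ) (a b : ℕ) : qInt q (a + b) = qInt q a + q ^ a * qInt q b := by
  unfold qInt
  rw [Finset.sum_range_add, Finset.mul_sum]
  simp [pow_add]

theorem qFact_succ (q : ℝ) (m : ℕ) : qFact q (m + 1) = qFact q m * qInt q (m + 1) :=
  Finset.prod_range_succ _ _

noncomputable def node (q : ℝ) (i : ℕ) : ℝ := -(1 / qInt q (i + 1))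

theorem node_mono {q : ℝ} (hq : 0 < q) : Monotone (node q) := by
  refine monotone_nat_of_le_succ fun i => ?_
  unfold node
  apply neg_le_neg
  apply one_div_le_one_div_of_le (qInt_pos hq i)
  rw [qInt_add q (i + 1) 1]
  have : 0 ≤ q ^ (i + 1) * qInt q 1 := mul_nonneg (pow_nonneg hq.le _) (qInt_pos hq 0).le
  linarith

theorem node_prod {q : ℝ} (hq : 0 < q) (J : ℕ) : ∀ d,
    (∏ s ∈ Finset.range J, (node q (J + d) - node q s)) * qInt q (J + d + 1) ^ J *
      (qFact q J * qFact q d) = q ^ ((J + 1).choose 2) * qFact q (J + d) := by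
  induction J with
  | zero => intro d; simp [qFact]
  | succ J ih =>
    intro d
    have h := ih (d + 1)
    have e : J + (d + 1) = J + 1 + d := by ring
    rw [e, qFact_succ q d] at h
    rw [Finset.prod_range_succ, qFact_succ q J, Nat.choose_succ_succ' (J + 1) 1,
      Nat.choose_one_right, pow_add q (J + 1), mul_assoc (q ^ (J + 1)), ← h]
    have hk : (node q (J + 1 + d) - node q J) * qInt q (J + 1 + d + 1) * qInt q (J + 1)
        = q ^ (J + 1) * qInt q (d + 1) := by
      have h1 := (qInt_pos hq J).ne'
      have h2 := (qInt_pos hq (J + 1 + d)).ne'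
      have h3 := qInt_add q (J + 1) (d + 1)
      rw [← add_assoc] at h3
      unfold node
      field_simp
      linarith
    rw [pow_succ]
    linear_combination ((∏ s ∈ Finset.range J, (node q (J + 1 + d) - node q s)) *
      qInt q (J + 1 + d + 1) ^ J * (qFact q J * qFact q d)) * hk

theorem entry {q α : ℝ} (hq : 0 < q) (hα : α < 0) (n : ℕ) (i j : Fin (n + 1)) :
    Lmat q α n i j = ((-α) ^ i.1 * qInt q i.1 ^ (i.1 - 1)) *
      (((-α)⁻¹) ^ j.1 * H (node q) 0 i.1 j.1) := by
  obtain ⟨i, hi⟩ := i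
  obtain ⟨j, hj⟩ := j
  have ha : -α ≠ 0 := by linarith
  simp only [Lmat, Matrix.of_apply]
  cases j with
  | zero => cases i <;> simp [H]
  | succ j =>
    cases i with
    | zero => simp [H]
    | succ i =>
      simp only [H, Nat.zero_min, Nat.sub_zero, G_prod, Nat.succ_ne_zero, if_false]
      by_cases hji : j ≤ i
      · obtain ⟨d, rfl⟩ := Nat.exists_eq_add_of_le hji
        have h := node_prod hq j d
        have e1 : j + d + 1 - (j + 1) = d := by omega
        have e2 : j + d + 1 - 1 = j + d := by omega
        have e3 : j + d - d = j := by omega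
        rw [if_pos (by omega), e1, e2, qBinom, if_pos (by omega), e3]
        have f1 := (qFact_pos hq j).ne'
        have f2 := (qFact_pos hq d).ne'
        have h' : q ^ ((j + 1).choose 2) * (qFact q (j + d) / (qFact q d * qFact q j)) =
          (∏ s ∈ Finset.range j, (node q (j + d) - node q s)) * qInt q (j + d + 1) ^ j := by
          field_simp
          linarith
        rw [mul_assoc, h', mul_pow, inv_pow]
        have e4 : j + d + 1 = d + (j + 1) := by ring
        rw [show (-α) ^ (j + d + 1) = (-α) ^ d * (-α) ^ (j + 1) by rw [e4, pow_add], pow_add _ j d]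
        have f3 := pow_ne_zero (j + 1) ha
        field_simp
      · rw [if_neg (by omega), Finset.prod_eq_zero (i := i) (by simp; omega) (by simp)]
        simp

theorem entry0 {q : ℝ} (hq : 0 < q) (n : ℕ) (i j : Fin (n + 1)) :
    Lmat q 0 n i j = 1 * (q ^ (j.1.choose 2) * if i.1 = j.1 then 1 else 0) := by
  obtain ⟨i, hi⟩ := i
  obtain ⟨j, hj⟩ := j
  simp only [Lmat, Matrix.of_apply]
  by_cases hj0 : j = 0
  · subst hj0; simp
  · rw [if_neg hj0]
    rcases lt_trichotomy i j with h | h | h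
    · simp [h.ne, h]
    · subst h
      have f2 := (qFact_pos hq (i - 1)).ne'
      have f3 : qFact q 0 = 1 := by simp [qFact]
      simp [qBinom, f2, f3]
    · have : i - j ≠ 0 := by omega
      simp [h.ne', this]

theorem TP.toFin {n : ℕ} {A : ℕ → ℕ → ℝ} {B : Matrix (Fin n) (Fin n) ℝ} (h : TP n A)
    (hB : ∀ i j, B i j = A i.1 j.1) : IsTotallyPos B := by
  intro k f g hf hg
  have := h k (fun a => (f a).1) (fun a => (g a).1) (fun _ _ h => hf h) (fun _ _ h => hg h)
    (fun a => (f a).2)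
  convert this using 2
  ext a b
  simp [hB]

end LTP

open LTP in
theorem Lmat_totallyPos_iff (q α : ℝ) (hq : 0 < q) :
    (∀ n : ℕ, IsTotallyPos (Lmat q α n)) ↔ α ≤ 0 := by
  constructor
  · intro h
    by_contra! hα
    have h1 := h 2 1 (fun _ => 2) (fun _ => 1) (Subsingleton.strictMono _)
      (Subsingleton.strictMono _)
    have f0 : qFact q 0 = 1 := by simp [qFact]
    have f1 : qFact q 1 = 1 := by simp [qFact, qInt]
    have h2 := qInt_pos hq 1
    simp [Lmat, qBinom, f0, f1] at h1
    norm_num at h2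
    nlinarith [mul_pos hα h2]
  · intro hα n
    rcases hα.lt_or_eq with hα | rfl
    · refine TP.toFin ((H_TP (node q) (node_mono hq) (n + 1)).scale
        (fun i => (-α) ^ i * qInt q i ^ (i - 1)) (fun j => ((-α)⁻¹) ^ j) ?_ ?_) (entry hq hα n)
      · intro i
        have ha : 0 ≤ -α := by linarith
        refine mul_nonneg (pow_nonneg ha _) (pow_nonneg ?_ _)
        exact Finset.sum_nonneg fun _ _ => pow_nonneg hq.le _
      · intro j
        have ha : 0 ≤ -α := by linarith
        exact pow_nonneg (inv_nonneg.2 ha) _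
    · exact TP.toFin ((TP_id (n + 1)).scale (fun _ => 1) (fun j => q ^ (j.choose 2))
        (fun _ => zero_le_one) (fun _ => pow_nonneg hq.le _)) (entry0 hq n)
end

section
/- With J := diag((-1)^{i-1})_{1 ≤ i ≤ n+1}, the matrix J L^{(q,α)} J is totally positive if and only if α ≥ 0. -/
open Finset Matrix

noncomputable def Jmat (n : ℕ) : Matrix (Fin (n + 1)) (Fin (n + 1)) ℝ :=
  Matrix.diagonal fun i => (-1 : ℝ) ^ (i : ℕ)


/-- Total positivity of the kernel `K` on rows `< N`. -/
def KTP (N : ℕ) (K : ℕ → ℕ → ℝ) : Prop :=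
  ∀ (k : ℕ) (f g : Fin k → ℕ), StrictMono f → StrictMono g → (∀ a, f a < N) →
    0 ≤ (Matrix.of fun a b => K (f a) (g b)).det

/-- The direct sum of the `1 × 1` identity and the kernel `K`. -/
def onePlus (K : ℕ → ℕ → ℝ) : ℕ → ℕ → ℝ
  | 0, 0 => 1
  | 0, _ + 1 => 0
  | _ + 1, 0 => 0
  | i + 1, j + 1 => K i j

lemma KTP.zero (K : ℕ → ℕ → ℝ) : KTP 0 K := by
  intro k f g _ _ hN
  cases k with
  | zero => simp
  | succ k => exact absurd (hN 0) (by simp)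

lemma KTP.shift {N : ℕ} {K : ℕ → ℕ → ℝ} (hK : KTP N K) (k : ℕ) (f g : Fin k → ℕ)
    (hf : StrictMono f) (hg : StrictMono g) (hN : ∀ a, f a < N + 1)
    (hf0 : ∀ a, 0 < f a) (hg0 : ∀ a, 0 < g a) :
    0 ≤ (Matrix.of fun a b => onePlus K (f a) (g b)).det := by
  have := hK k (fun a => f a - 1) (fun a => g a - 1)
    (fun a b hab => by have := hf hab; have := hf0 a; simp only; omega)
    (fun a b hab => by have := hg hab; have := hg0 a; simp only; omega)
    (fun a => by have := hN a; have := hf0 a; omega)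
  convert this using 2
  ext a b
  simp only [Matrix.of_apply]
  obtain ⟨c, hc⟩ := Nat.exists_eq_succ_of_ne_zero (hf0 a).ne'
  obtain ⟨d, hd⟩ := Nat.exists_eq_succ_of_ne_zero (hg0 b).ne'
  rw [hc, hd]; rfl

lemma KTP.onePlus {N : ℕ} {K : ℕ → ℕ → ℝ} (hK : KTP N K) : KTP (N + 1) (onePlus K) := by
  intro k f g hf hg hN
  cases k with
  | zero => simp
  | succ k =>
    have hfs : ∀ a : Fin k, 0 < f a.succ := fun a => lt_of_le_of_lt (Nat.zero_le _) (hf (Fin.succ_pos a))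
    have hgs : ∀ a : Fin k, 0 < g a.succ := fun a => lt_of_le_of_lt (Nat.zero_le _) (hg (Fin.succ_pos a))
    have z1 : ∀ j, 0 < j → _root_.onePlus K 0 j = 0 := by
      intro j hj; cases j with
      | zero => omega
      | succ j => rfl
    have z2 : ∀ j, 0 < j → _root_.onePlus K j 0 = 0 := by
      intro j hj; cases j with
      | zero => omega
      | succ j => rfl
    have all : ∀ h : Fin (k+1) → ℕ, StrictMono h → 0 < h 0 → ∀ a, 0 < h a := fun h hh h0 a =>
      lt_of_lt_of_le h0 (hh.monotone (Fin.zero_le a))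
    by_cases hf0 : f 0 = 0
    · by_cases hg0 : g 0 = 0
      · rw [Matrix.det_succ_row_zero, Fin.sum_univ_succ, Finset.sum_eq_zero]
        · have := hK.shift k (fun a => f a.succ) (fun a => g a.succ)
            (fun a b hab => hf (Fin.succ_lt_succ_iff.2 hab))
            (fun a b hab => hg (Fin.succ_lt_succ_iff.2 hab)) (fun a => hN _) hfs hgs
          have h1 : _root_.onePlus K 0 0 = 1 := rfl
          simp only [Matrix.of_apply, hf0, hg0, h1, Fin.val_zero, pow_zero, one_mul, add_zero]
          convert this using 2
          ext a b
          simp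
        · intro b _
          simp only [Matrix.of_apply, hf0, z1 _ (hgs b)]
          simp
      · rw [Matrix.det_eq_zero_of_row_eq_zero 0]
        intro b
        simp only [Matrix.of_apply, hf0]
        exact z1 _ (all g hg (Nat.pos_of_ne_zero hg0) b)
    · by_cases hg0 : g 0 = 0
      · rw [Matrix.det_eq_zero_of_column_eq_zero 0]
        intro a
        simp only [Matrix.of_apply, hg0]
        exact z2 _ (all f hf (Nat.pos_of_ne_zero hf0) a)
      · exact hK.shift _ f g hf hg hN (all f hf (Nat.pos_of_ne_zero hf0))
          (all g hg (Nat.pos_of_ne_zero hg0))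

lemma KTP.bidiag {N : ℕ} {K K' : ℕ → ℕ → ℝ} (w : ℕ → ℝ) (hw : ∀ j, 0 ≤ w j)
    (hK : KTP N K) (h : ∀ i j, K' i j = w j * K i j + K i (j + 1)) : KTP N K' := by
  intro k f g hf hg hN
  rw [← Matrix.det_transpose]
  have e : (Matrix.of fun a b => K' (f a) (g b))ᵀ =
      (fun b a => w (g b) * K (f a) (g b)) + (fun b a => K (f a) (g b + 1)) := by
    ext b a
    simp [h]
  rw [e]
  change 0 ≤ (Matrix.detRowAlternating (R := ℝ) (n := Fin k)).toMultilinearMap _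
  rw [MultilinearMap.map_add_univ]
  refine Finset.sum_nonneg fun s _ => ?_
  let g' : Fin k → ℕ := fun b => if b ∈ s then g b else g b + 1
  let c : Fin k → ℝ := fun b => if b ∈ s then w (g b) else 1
  have e2 : (s.piecewise (fun b a => w (g b) * K (f a) (g b)) (fun b a => K (f a) (g b + 1)) :
      Fin k → Fin k → ℝ) = fun b => c b • (fun a => K (f a) (g' b)) := by
    ext b a
    by_cases hb : b ∈ s <;> simp [hb, c, g']
  rw [e2, MultilinearMap.map_smul_univ, smul_eq_mul]
  refine mul_nonneg (Finset.prod_nonneg fun b _ => ?_) ?_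
  · by_cases hb : b ∈ s <;> simp [hb, c, hw]
  change 0 ≤ Matrix.det (Matrix.of fun a b => K (f a) (g' b))ᵀ
  rw [Matrix.det_transpose]
  by_cases hs : StrictMono g'
  · exact hK k f g' hf hs hN
  · have : ∃ a b, a < b ∧ g' a = g' b := by
      simp only [StrictMono, not_forall] at hs
      obtain ⟨a, b, hab, h1⟩ := hs
      refine ⟨a, b, hab, ?_⟩
      have := hg hab
      simp only [g'] at h1 ⊢
      split_ifs at h1 ⊢ <;> omega
    obtain ⟨a, b, hab, h1⟩ := this
    rw [Matrix.det_zero_of_column_eq hab.ne]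
    intro i
    simp [h1]

lemma KTP.scale {N : ℕ} {K K' : ℕ → ℕ → ℝ} (r c : ℕ → ℝ) (hr : ∀ j, 0 ≤ r j) (hc : ∀ j, 0 ≤ c j)
    (hK : KTP N K) (h : ∀ i j, K' i j = r i * (c j * K i j)) : KTP N K' := by
  intro k f g hf hg hN
  have e : (Matrix.of fun a b => K' (f a) (g b)) =
      Matrix.of fun a b => r (f a) * (Matrix.of fun a b => c (g b) *
        (Matrix.of fun a b => K (f a) (g b)) a b) a b := by
    ext a b; simp [h]
  rw [e, Matrix.det_mul_column, Matrix.det_mul_row]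
  exact mul_nonneg (Finset.prod_nonneg fun _ _ => hr _)
    (mul_nonneg (Finset.prod_nonneg fun _ _ => hc _) (hK k f g hf hg hN))

/-- Newton basis kernel. -/
def newtonK (x : ℕ → ℝ) (i j : ℕ) : ℝ := ∏ m ∈ Finset.range j, (x i - x m)

lemma newtonK_TP (N : ℕ) : ∀ x : ℕ → ℝ, Monotone x → KTP N (newtonK x) := by
  induction N with
  | zero => intro x _; exact KTP.zero _
  | succ N ih =>
    intro x hx
    have h1 := (ih (fun i => x (i + 1)) (fun a b hab => hx (by omega))).onePlus
    refine h1.bidiag (fun j => if j = 0 then 1 else x j - x 0) ?_ ?_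
    · intro j
      split_ifs
      · norm_num
      · exact sub_nonneg.2 (hx (Nat.zero_le _))
    · intro i j
      rcases i with _ | i <;> rcases j with _ | j
      · simp [newtonK, onePlus]
      · simp [newtonK, onePlus, Finset.prod_range_succ']
      · simp [newtonK, onePlus]
      · have e1 : newtonK x (i + 1) (j + 1) =
            (∏ m ∈ Finset.range j, (x (i + 1) - x (m + 1))) * (x (i + 1) - x 0) :=
          Finset.prod_range_succ' _ _
        have e2 : onePlus (newtonK fun i => x (i + 1)) (i + 1) (j + 1 + 1) =
            (∏ m ∈ Finset.range j, (x (i + 1) - x (m + 1))) * (x (i + 1) - x (j + 1)) :=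
          Finset.prod_range_succ _ _
        rw [e1, e2, if_neg (by omega)]
        simp only [onePlus, newtonK]
        ring

lemma idK_TP (N : ℕ) : KTP N (fun i j => if i = j then 1 else 0) := by
  induction N with
  | zero => exact KTP.zero _
  | succ N ih =>
    convert ih.onePlus using 3 with i j
    rcases i with _ | i <;> rcases j with _ | j <;> simp [onePlus]

lemma qInt_pos {q : ℝ} (hq : 0 < q) (m : ℕ) : 0 < qInt q (m + 1) :=
  Finset.sum_pos (fun _ _ => pow_pos hq _) (by simp)

lemma qFact_pos {q : ℝ} (hq : 0 < q) (m : ℕ) : 0 < qFact q m :=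
  Finset.prod_pos fun _ _ => qInt_pos hq _

lemma qBinom_nonneg {q : ℝ} (hq : 0 < q) (m k : ℕ) : 0 ≤ qBinom q m k := by
  unfold qBinom
  split_ifs
  · have := qFact_pos hq m
    have := qFact_pos hq k
    have := qFact_pos hq (m - k)
    positivity
  · rfl

lemma qInt_add (q : ℝ) (a b : ℕ) : qInt q (a + b) = qInt q a + q ^ a * qInt q b := by
  simp [qInt, Finset.sum_range_add, pow_add, Finset.mul_sum]

/-- The kernel of the lower right block. -/
noncomputable def coreK (q α : ℝ) (i j : ℕ) : ℝ :=
  if j ≤ i then (α * qInt q (i + 1)) ^ (i - j) * q ^ ((j + 1).choose 2) * qBinom q i (i - j) else 0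

noncomputable def nodes (q : ℝ) (i : ℕ) : ℝ := -(qInt q (i + 1))⁻¹

lemma nodes_mono {q : ℝ} (hq : 0 < q) : Monotone (nodes q) := by
  refine monotone_nat_of_le_succ fun i => ?_
  unfold nodes
  apply neg_le_neg
  apply inv_anti₀ (qInt_pos hq i)
  rw [qInt_add q (i + 1) 1]
  have : 0 < qInt q 1 := qInt_pos hq 0
  have := mul_pos (pow_pos hq (i + 1)) this
  linarith

lemma newton_nodes {q : ℝ} (hq : 0 < q) (i j : ℕ) (h : j ≤ i) :
    newtonK (nodes q) i j * qInt q (i + 1) ^ j = q ^ ((j + 1).choose 2) * qBinom q i (i - j) := by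
  have hb : qBinom q i (i - j) = qFact q i / (qFact q (i - j) * qFact q j) := by
    unfold qBinom
    rw [if_pos (by omega), Nat.sub_sub_self h]
  rw [hb]
  induction j with
  | zero => simp [newtonK, qFact, (qFact_pos hq i).ne']; exact (div_self (qFact_pos hq i).ne').symm
  | succ j ih =>
    have hb' : qBinom q i (i - j) = qFact q i / (qFact q (i - j) * qFact q j) := by
      unfold qBinom
      rw [if_pos (by omega), Nat.sub_sub_self (by omega)]
    have ih := ih (by omega) hb'
    obtain ⟨d, rfl⟩ := Nat.exists_eq_add_of_le h
    have s1 : j + 1 + d - j = d + 1 := by omega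
    have s2 : j + 1 + d - (j + 1) = d := by omega
    rw [s1] at ih
    rw [s2]
    have e1 : newtonK (nodes q) (j + 1 + d) (j + 1) =
      newtonK (nodes q) (j + 1 + d) j * (nodes q (j + 1 + d) - nodes q j) := by
      simp [newtonK, Finset.prod_range_succ]
    have e2 : qFact q (d + 1) = qFact q d * qInt q (d + 1) := by
      simp [qFact, Finset.prod_range_succ]
    have e3 : qFact q (j + 1) = qFact q j * qInt q (j + 1) := by
      simp [qFact, Finset.prod_range_succ]
    have e4 : (j + 1 + 1).choose 2 = (j + 1).choose 2 + (j + 1) := by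
      rw [Nat.choose_succ_succ' (j + 1) 1]; simp; ring
    have e5 : qInt q (j + 1 + d + 1) = qInt q (j + 1) + q ^ (j + 1) * qInt q (d + 1) := by
      rw [← qInt_add]; rfl
    have p1 := (qInt_pos hq j).ne'
    have p2 := (qInt_pos hq d).ne'
    have p3 := (qInt_pos hq (j + 1 + d)).ne'
    have p4 := (qFact_pos hq j).ne'
    have p5 := (qFact_pos hq d).ne'
    have e6 : (nodes q (j + 1 + d) - nodes q j) * qInt q (j + 1 + d + 1) =
        q ^ (j + 1) * qInt q (d + 1) / qInt q (j + 1) := by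
      unfold nodes
      field_simp
      rw [e5]; ring
    calc _ = (newtonK (nodes q) (j + 1 + d) j * qInt q (j + 1 + d + 1) ^ j) *
          ((nodes q (j + 1 + d) - nodes q j) * qInt q (j + 1 + d + 1)) := by
            rw [e1, pow_succ]; ring
      _ = _ := by
        rw [ih, e6, e2, e3, e4]
        field_simp
        ring

lemma coreK_TP {q α : ℝ} (hq : 0 < q) (hα : 0 ≤ α) (N : ℕ) : KTP N (coreK q α) := by
  rcases hα.eq_or_lt with rfl | hα
  · refine (idK_TP N).scale (fun _ => 1) (fun j => q ^ ((j + 1).choose 2) * qBinom q j 0)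
      (fun _ => zero_le_one) (fun j => mul_nonneg (pow_nonneg hq.le _) (qBinom_nonneg hq _ _)) ?_
    intro i j
    unfold coreK
    by_cases hij : i = j
    · subst hij; simp
    · by_cases h : j ≤ i
      · have : i - j ≠ 0 := by omega
        simp [hij, this]
      · simp [hij, h]
  · refine (newtonK_TP N (nodes q) (nodes_mono hq)).scale (fun i => (α * qInt q (i + 1)) ^ i)
      (fun j => (α ^ j)⁻¹) (fun i => pow_nonneg (mul_nonneg hα.le (qInt_pos hq i).le) _)
      (fun j => by positivity) ?_
    intro i j
    unfold coreK
    split_ifs with h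
    · rw [mul_assoc, ← newton_nodes hq i j h]
      obtain ⟨d, rfl⟩ := Nat.exists_eq_add_of_le h
      simp only [Nat.add_sub_cancel_left]
      rw [mul_pow, mul_pow, pow_add, pow_add]
      field_simp
    · have : newtonK (nodes q) i j = 0 :=
        Finset.prod_eq_zero (Finset.mem_range.2 (not_le.1 h)) (sub_self _)
      simp [this]

lemma JLJ_apply (q α : ℝ) (n : ℕ) (i j : Fin (n + 1)) :
    (Jmat n * Lmat q α n * Jmat n) i j = onePlus (coreK q α) i.1 j.1 := by
  rw [Jmat, Matrix.mul_diagonal, Matrix.diagonal_mul, Lmat, Matrix.of_apply]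
  generalize i.1 = i
  generalize j.1 = j
  rcases i with _ | i <;> rcases j with _ | j
  · simp [onePlus]
  · simp [onePlus]
  · simp [onePlus]
  · simp only [onePlus, coreK, Nat.add_le_add_iff_right, Nat.add_sub_add_right, Nat.add_sub_cancel]
    rw [if_neg (by omega)]
    split_ifs with h
    · obtain ⟨d, rfl⟩ := Nat.exists_eq_add_of_le h
      simp only [Nat.add_sub_cancel_left]
      have e : (-1 : ℝ) ^ (j + d + 1) * (-1) ^ (j + 1) * (-1) ^ d = 1 := by
        rw [← pow_add, ← pow_add]
        exact Even.neg_one_pow ⟨j + d + 1, by ring⟩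
      rw [neg_mul, neg_pow]
      linear_combination ((α * qInt q (j + d + 1)) ^ d * q ^ ((j + 1).choose 2) * qBinom q (j + d) d) * e
    · simp

theorem JLmatJ_totallyPos_iff (q α : ℝ) (hq : 0 < q) :
    (∀ n : ℕ, IsTotallyPos (Jmat n * Lmat q α n * Jmat n)) ↔ 0 ≤ α := by
  constructor
  · intro h
    have h1 := h 2 1 (fun _ => 2) (fun _ => 1) (Subsingleton.strictMono _) (Subsingleton.strictMono _)
    rw [Matrix.det_fin_one, Matrix.submatrix_apply, JLJ_apply] at h1
    change 0 ≤ coreK q α 1 0 at h1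
    have hF : qFact q 1 / (qFact q 1 * qFact q 0) = 1 := by simp [qFact, qInt]
    simp [coreK, qBinom, hF] at h1
    have := qInt_pos hq 1
    exact nonneg_of_mul_nonneg_left h1 this
  · intro hα n k f g hf hg
    have := (coreK_TP hq hα n).onePlus k (fun a => (f a).1) (fun a => (g a).1)
      (fun a b hab => hf hab) (fun a b hab => hg hab) (fun a => (f a).2)
    convert this using 2
    ext a b
    rw [Matrix.submatrix_apply, JLJ_apply]; rfl
end

section
/- For α ≤ 0, the Gramian matrix G^{(q,α)} := (∫_0^1 A_{i-1}^{(q,α)}(x) A_{j-1}^{(q,α)}(x) dx)_{1 ≤ i,j ≤ n+1} of the q-Abel basis with respect to the L²(0,1) inner product is strictly totally positive. -/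
open Finset Matrix

noncomputable def qAbel (q α : ℝ) (m : ℕ) (x : ℝ) : ℝ :=
  if m = 0 then 1 else x * ∏ j ∈ Finset.Icc 1 (m - 1), (x * q ^ j - α * qInt q m)

namespace QAbelAux

/-- Cauchy determinants are positive. -/
lemma cauchy_pos : ∀ (k : ℕ) (x y : Fin k → ℝ), StrictMono x → StrictMono y →
    (∀ i j, 0 < x i + y j) → 0 < (Matrix.of fun i j : Fin k => 1 / (x i + y j)).det := by
  intro k
  induction k with
  | zero => intro x y _ _ _; simp
  | succ k ih =>
    intro x y hx hy hxy
    set A : Matrix (Fin (k+1)) (Fin (k+1)) ℝ := Matrix.of fun i j => 1 / (x i + y j) with hA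
    let c : Fin (k+1) → ℝ := Fin.cons 0 (fun i : Fin k => (x 0 + y 0) / (x i.succ + y 0))
    let B : Matrix (Fin (k+1)) (Fin (k+1)) ℝ := Matrix.of fun i j => A i j - c i * A 0 j
    have hc0 : c 0 = 0 := rfl
    have hcs : ∀ i : Fin k, c i.succ = (x 0 + y 0) / (x i.succ + y 0) := fun i => rfl
    have h1 : A.det = B.det := by
      apply det_eq_of_forall_row_eq_smul_add_const c 0 hc0
      intro i j
      simp [B, hc0]
    have hB0 : ∀ i : Fin k, B i.succ 0 = 0 := by
      intro i
      have e1 := (hxy i.succ 0).ne'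
      have e2 := (hxy 0 0).ne'
      simp only [B, A, Matrix.of_apply, hcs]
      field_simp
      ring
    have h2 : B.det = B 0 0 * (B.submatrix Fin.succ Fin.succ).det := by
      rw [det_succ_column_zero, Fin.sum_univ_succ]
      simp only [hB0]
      simp
    let C : Matrix (Fin k) (Fin k) ℝ := Matrix.of fun i j => 1 / (x i.succ + y j.succ)
    let r : Fin k → ℝ := fun i => (x i.succ - x 0) / (x i.succ + y 0)
    let s : Fin k → ℝ := fun j => (y j.succ - y 0) / (x 0 + y j.succ)
    have h3 : B.submatrix Fin.succ Fin.succ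
        = Matrix.of fun i j => r i * (Matrix.of fun i j => s j * C i j) i j := by
      ext i j
      have e1 := (hxy i.succ 0).ne'
      have e2 := (hxy 0 0).ne'
      have e3 := (hxy i.succ j.succ).ne'
      have e4 := (hxy 0 j.succ).ne'
      simp only [B, A, C, r, s, Matrix.of_apply, Matrix.submatrix_apply, hcs]
      field_simp
      ring
    rw [h1, h2, h3, det_mul_column, det_mul_row]
    have hC : 0 < C.det := ih (fun i => x i.succ) (fun i => y i.succ)
      (hx.comp (Fin.strictMono_succ)) (hy.comp Fin.strictMono_succ) (fun i j => hxy _ _)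
    have hB00 : 0 < B 0 0 := by
      simp only [B, A, Matrix.of_apply, hc0]
      have := hxy 0 0
      simp [this]
    have hr : 0 < ∏ i, r i := Finset.prod_pos fun i _ =>
      div_pos (sub_pos.2 (hx (Fin.succ_pos i))) (hxy _ _)
    have hs : 0 < ∏ i, s i := Finset.prod_pos fun i _ =>
      div_pos (sub_pos.2 (hy (Fin.succ_pos i))) (hxy _ _)
    positivity

/-- Strict total positivity of an infinite array. -/
def STP (R : ℕ → ℕ → ℝ) : Prop :=
  ∀ (k : ℕ) (f g : Fin k → ℕ), StrictMono f → StrictMono g →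
    0 < (Matrix.of fun i j : Fin k => R (f i) (g j)).det

lemma STP.transpose {R : ℕ → ℕ → ℝ} (h : STP R) : STP (fun i j => R j i) := by
  intro k f g hf hg
  have := h k g f hg hf
  rw [← det_transpose] at this
  exact this

lemma STP.update {R : ℕ → ℕ → ℝ} (h : STP R) (m : ℕ) (d c : ℝ) (hd : 0 < d) (hc : 0 ≤ c) :
    STP (Function.update R (m+1) (d • R (m+1) + c • R m)) := by
  intro k f g hf hg
  by_cases hm : ∃ i, f i = m + 1
  · obtain ⟨i0, hi0⟩ := hm
    set A : Matrix (Fin k) (Fin k) ℝ := Matrix.of fun i j : Fin k => R (f i) (g j) with hA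
    have hApos : 0 < A.det := h k f g hf hg
    have e : (Matrix.of fun i j : Fin k =>
        Function.update R (m+1) (d • R (m+1) + c • R m) (f i) (g j))
        = A.updateRow i0 (d • A i0 + c • fun j => R m (g j)) := by
      ext i j
      by_cases hi : i = i0
      · subst hi
        simp [hi0, hA]
      · have : f i ≠ m + 1 := fun h' => hi (hf.injective (h'.trans hi0.symm))
        simp [hi, this, hA]
    rw [e, det_updateRow_add, det_updateRow_smul, det_updateRow_smul, updateRow_eq_self]
    have : 0 ≤ (A.updateRow i0 fun j => R m (g j)).det := by
      by_cases hm : ∃ i, f i = m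
      · obtain ⟨i1, hi1⟩ := hm
        have hne : i1 ≠ i0 := by rintro rfl; omega
        have := det_updateRow_eq_zero (M := A) hne
        apply le_of_eq
        rw [← this]
        congr 2
        ext j
        simp [hA, hi1]
      · push Not at hm
        have hf' : StrictMono (Function.update f i0 m) := by
          intro a b hab
          have h1 := hf hab
          have ha := hm a
          by_cases h2 : a = i0
          · subst h2
            have : b ≠ a := hab.ne'
            simp [this]; omega
          · by_cases h3 : b = i0
            · subst h3
              simp [h2]; omega
            · simp [h2, h3, h1]
        have := h k _ g hf' hg
        apply le_of_lt
        refine lt_of_lt_of_eq this (congrArg Matrix.det ?_)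
        ext i j
        by_cases hi : i = i0
        · subst hi; simp
        · simp [hi, hA]
    have := mul_nonneg hc this
    have := mul_pos hd hApos
    linarith
  · push Not at hm
    have := h k f g hf hg
    convert this using 4 with i j
    simp [hm i]

lemma STP.smul0 {R : ℕ → ℕ → ℝ} (h : STP R) (d : ℝ) (hd : 0 < d) :
    STP (Function.update R 0 (d • R 0)) := by
  intro k f g hf hg
  have hApos := h k f g hf hg
  have e : (Matrix.of fun i j : Fin k => Function.update R 0 (d • R 0) (f i) (g j))
      = Matrix.of fun i j => (if f i = 0 then d else 1) *
          (Matrix.of fun i j : Fin k => R (f i) (g j)) i j := by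
    ext i j
    by_cases hi : f i = 0
    · simp [hi]
    · simp [hi]
  rw [e, det_mul_column]
  refine mul_pos (Finset.prod_pos fun i _ => ?_) hApos
  split_ifs <;> positivity

lemma STP.stage {R : ℕ → ℕ → ℝ} (h : STP R) (S : ℕ → ℕ → ℝ) (d c : ℕ → ℝ)
    (hd : ∀ m, 0 < d m) (hc : ∀ m, 0 ≤ c m) (h0 : S 0 = d 0 • R 0)
    (hS : ∀ m, S (m+1) = d (m+1) • R (m+1) + c (m+1) • S m) : STP S := by
  have key : ∀ M, STP (fun m => if m < M + 1 then S m else R m) := by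
    intro M
    induction M with
    | zero =>
      convert h.smul0 (d 0) (hd 0) using 1
      ext m : 1
      rcases m with _ | m
      · simp [h0]
      · simp
    | succ M ih =>
      convert ih.update M (d (M+1)) (c (M+1)) (hd _) (hc _) using 1
      ext m : 1
      by_cases hm : m = M + 1
      · subst hm
        simp [hS]
      · rw [Function.update_of_ne hm]
        have : m < M + 1 + 1 ↔ m < M + 1 := by omega
        simp only [this]
  intro k f g hf hg
  have := key (∑ i, f i) k f g hf hg
  convert this using 4 with i j
  have : f i < ∑ i, f i + 1 := Nat.lt_succ_of_le (Finset.single_le_sum (f := f) (by simp) (Finset.mem_univ i))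
  simp [this]

/-- Divided difference at nodes `v a, …, v m` of the `k`-th Newton polynomial. -/
def E (v : ℕ → ℝ) : ℕ → ℕ → ℕ → ℝ
  | 0, a, m => if a = m then 1 else 0
  | k+1, a, m => (v m - v k) * E v k a m + if a < m then E v k a (m-1) else 0

lemma E_rec (v : ℕ → ℝ) (k : ℕ) : ∀ a m, a ≤ m →
    (v (m+1) - v a) * E v k a (m+1) = E v k (a+1) (m+1) - E v k a m := by
  induction k with
  | zero =>
    intro a m ham
    have : a ≠ m + 1 := by omega
    simp [E, this]
  | succ k ih =>
    intro a m ham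
    have h1 := ih a m ham
    have e1 : a < m + 1 := by omega
    simp only [E, e1, if_true, Nat.add_sub_cancel]
    rcases Nat.lt_or_ge a m with h | h
    · obtain ⟨m, rfl⟩ : ∃ m', m = m' + 1 := ⟨m - 1, by omega⟩
      have h2 := ih a m (by omega)
      have e2 : a + 1 < m + 1 + 1 := by omega
      simp only [h, e2, if_true, Nat.add_sub_cancel]
      linear_combination (v (m+1+1) - v k) * h1 + h2
    · obtain rfl : a = m := by omega
      simp only [lt_irrefl, if_false]
      linear_combination (v (a+1) - v k) * h1

lemma E_diag (v : ℕ → ℝ) (k m : ℕ) : E v k m m = ∏ i ∈ range k, (v m - v i) := by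
  induction k with
  | zero => simp [E]
  | succ k ih => simp [E, ih, prod_range_succ, mul_comm]

lemma E_zero (v : ℕ → ℝ) (k m : ℕ) : E v k 0 m = if m = k then 1 else 0 := by
  induction k generalizing m with
  | zero => simp [E, eq_comm]
  | succ k ih =>
    rw [E, ih]
    rcases m with _ | m
    · rw [if_neg (lt_irrefl _)]
      by_cases h : 0 = k
      · subst h; simp
      · simp [h]
    · rw [if_pos (Nat.succ_pos _), Nat.add_sub_cancel, ih]
      by_cases h : m + 1 = k
      · subst h; simp
      · simp [h]

lemma E_gt (v : ℕ → ℝ) (k a m : ℕ) (h : m < k) : E v k a m = 0 := by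
  induction k generalizing m with
  | zero => omega
  | succ k ih =>
    rw [E]
    rcases Nat.lt_or_ge m k with h1 | h1
    · rw [ih _ h1, ih _ (by omega)]; simp
    · obtain rfl : m = k := by omega
      rcases m with _ | m
      · simp
      · rw [Nat.add_sub_cancel, ih m (by omega)]; simp

/-- Newton collocation (on indices ≥ 1) preserves STP. -/
lemma STP.newton {R : ℕ → ℕ → ℝ} (h : STP R) (v : ℕ → ℝ) (hv : StrictMono v) :
    STP (fun m => match m with
      | 0 => R 0
      | m+1 => ∑ k ∈ range (m+1), (∏ i ∈ range k, (v m - v i)) • R (k+1)) := by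
  -- stage `j`, rows
  let W : ℕ → ℕ → ℕ → ℝ := fun j m => match m with
      | 0 => R 0
      | m+1 => ∑ k ∈ range (m+1), (E v k (m-j) m) • R (k+1)
  have hW0 : W 0 = (fun m => match m with
      | 0 => R 0
      | m+1 => ∑ k ∈ range (m+1), (∏ i ∈ range k, (v m - v i)) • R (k+1)) := by
    ext m : 1
    rcases m with _ | m
    · rfl
    · simp only [W, Nat.sub_zero, E_diag]
  -- truncation at row `N`
  have hlast : ∀ j m, m ≤ j → W j m = R m := by
    intro j m hm
    rcases m with _ | m
    · rfl
    · have e : m - j = 0 := by omega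
      simp only [W, e, E_zero]
      rw [Finset.sum_eq_single m]
      · simp
      · intro k _ hk; simp [hk.symm]
      · simp
  have hstep : ∀ N j, STP (fun m => if m ≤ N then W (j+1) m else R m) →
      STP (fun m => if m ≤ N then W j m else R m) := by
    intro N j hj
    refine hj.stage _ (fun m => if j + 2 ≤ m ∧ m ≤ N then v (m-1) - v (m-1-j-1) else 1)
      (fun m => if j + 2 ≤ m ∧ m ≤ N then 1 else 0) ?_ ?_ ?_ ?_
    · intro m
      split_ifs with hm
      · exact sub_pos.2 (hv (by omega))
      · exact one_pos
    · intro m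
      split_ifs <;> simp
    · simp [W]
    · intro m
      by_cases hN : m + 1 ≤ N
      swap
      · simp [hN]
      have hN' : m ≤ N := by omega
      by_cases hm : j + 2 ≤ m + 1
      · obtain ⟨m, rfl⟩ : ∃ m', m = m' + 1 := ⟨m - 1, by omega⟩
        simp only [hm, hN, hN', and_self, if_true, W, Nat.add_sub_cancel, one_smul]
        have hsum : ∑ k ∈ range (m+1), (E v k (m-j) m) • R (k+1)
            = ∑ k ∈ range (m+1+1), (E v k (m-j) m) • R (k+1) := by
          rw [sum_range_succ _ (m+1), E_gt _ _ _ _ (Nat.lt_succ_self m)]; simp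
        rw [hsum, Finset.smul_sum, ← Finset.sum_add_distrib]
        refine Finset.sum_congr rfl fun k _ => ?_
        rw [smul_smul, ← add_smul]
        congr 1
        have := E_rec v k (m-j) m (Nat.sub_le _ _)
        have e1 : m + 1 - j = m - j + 1 := by omega
        have e2 : m + 1 - j - 1 = m - j := by omega
        have e3 : m + 1 - (j + 1) = m - j := by omega
        rw [e2, e3, e1, this]
        ring
      · simp only [hm, hN, hN', false_and, if_true, if_false, one_smul, zero_smul, add_zero, W]
        have e1 : m - j = 0 := by omega
        have e2 : m - (j+1) = 0 := by omega
        rw [e1, e2]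
  have hdown : ∀ N j, STP (fun m => if m ≤ N then W j m else R m) →
      STP (fun m => if m ≤ N then W 0 m else R m) := by
    intro N j
    induction j with
    | zero => exact id
    | succ j ih => exact fun hj => ih (hstep N j hj)
  rw [← hW0]
  intro k f g hf hg
  have hN : STP (fun m => if m ≤ ∑ i, f i then W (∑ i, f i) m else R m) := by
    convert h using 1
    ext m : 1
    split_ifs with hm
    · exact hlast _ _ hm
    · rfl
  have := hdown _ _ hN k f g hf hg
  convert this using 4 with i j
  have : f i ≤ ∑ i, f i := Finset.single_le_sum (f := f) (by simp) (Finset.mem_univ i)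
  simp [this]

lemma qInt_pos (q : ℝ) (hq : 0 < q) (m : ℕ) : 0 < qInt q (m+1) := by
  unfold qInt
  exact Finset.sum_pos (fun i _ => by positivity) (by simp)

lemma qInt_succ (q : ℝ) (m : ℕ) : qInt q (m+1) = qInt q m + q ^ m := by
  simp [qInt, sum_range_succ]

lemma qInt_succ' (q : ℝ) (m : ℕ) : qInt q (m+1) = 1 + q * qInt q m := by
  unfold qInt
  rw [sum_range_succ', mul_sum]
  simp [pow_succ', add_comm]

lemma qInt_add (q : ℝ) (m k : ℕ) : qInt q (m+k) = qInt q m + q ^ m * qInt q k := by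
  unfold qInt
  rw [sum_range_add, mul_sum]
  simp [pow_add]

/-- `q`-binomial coefficient as a product. -/
noncomputable def b (q : ℝ) (m k : ℕ) : ℝ :=
  ∏ i ∈ range k, (qInt q m - qInt q i) / qInt q (i+1)

lemma b_gt (q : ℝ) (m k : ℕ) (h : m < k) : b q m k = 0 := by
  unfold b
  exact prod_eq_zero (mem_range.2 h) (by simp)

lemma b_shift (q : ℝ) (hq : 0 < q) (m k : ℕ) :
    b q (m+1) (k+1) = b q m k * q ^ k * qInt q (m+1) / qInt q (k+1) := by
  unfold b
  rw [prod_div_distrib, prod_div_distrib, prod_range_succ' (fun i => qInt q (m+1) - qInt q i),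
    prod_range_succ (fun i => qInt q (i+1))]
  have h0 : qInt q 0 = 0 := by simp [qInt]
  have : ∀ i, qInt q (m+1) - qInt q (i+1) = q * (qInt q m - qInt q i) := by
    intro i; rw [qInt_succ', qInt_succ']; ring
  simp only [this, prod_mul_distrib, prod_const, card_range, h0]
  have h1 : ∏ i ∈ range k, qInt q (i+1) ≠ 0 := prod_ne_zero_iff.2 fun i _ => (qInt_pos q hq i).ne'
  have h2 := (qInt_pos q hq k).ne'
  field_simp
  ring

lemma b_pascal (q : ℝ) (hq : 0 < q) (m k : ℕ) :
    b q (m+1) (k+1) = b q m (k+1) + q ^ m * b q m k := by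
  rw [b_shift q hq]
  have : b q m (k+1) = b q m k * ((qInt q m - qInt q k) / qInt q (k+1)) := by
    rw [b, prod_range_succ, b]
  rw [this]
  have h2 := (qInt_pos q hq k).ne'
  have e1 := qInt_add q k (m+1)
  have e2 := qInt_add q m (k+1)
  rw [show k + (m+1) = m + (k+1) by ring] at e1
  field_simp
  linear_combination (b q m k) * (e2 - e1)

lemma qbinomial (q : ℝ) (hq : 0 < q) (z : ℝ) (m : ℕ) :
    ∏ j ∈ Finset.Icc 1 m, (z * q ^ j + 1) = ∑ k ∈ range (m+1), b q m k * (q * z) ^ k := by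
  induction m with
  | zero => simp [b]
  | succ m ih =>
    rw [prod_Icc_succ_top (by omega), ih, sum_range_succ' _ (m+1)]
    simp only [b_pascal q hq, add_mul, sum_add_distrib]
    have e : ∑ k ∈ range (m+1), b q m (k+1) * (q*z)^(k+1) + b q (m+1) 0 * (q*z)^0
        = ∑ k ∈ range (m+1), b q m k * (q * z) ^ k := by
      have h1 := sum_range_succ' (fun k => b q m k * (q * z) ^ k) (m+1)
      have h2 := sum_range_succ (fun k => b q m k * (q * z) ^ k) (m+1)
      rw [b_gt q m (m+1) (Nat.lt_succ_self m)] at h2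
      have h3 : b q (m+1) 0 = b q m 0 := by simp [b]
      rw [h3]
      linarith
    rw [mul_add, mul_one, ← e, add_right_comm, add_comm]
    congr 1
    rw [e, sum_mul]
    refine sum_congr rfl fun k _ => ?_
    ring

/-- nodes -/
noncomputable def vn (q : ℝ) (m : ℕ) : ℝ := - (qInt q (m+1))⁻¹

lemma vn_mono (q : ℝ) (hq : 0 < q) : StrictMono (vn q) := by
  apply strictMono_nat_of_lt_succ
  intro m
  unfold vn
  have h1 := qInt_pos q hq m
  have h2 : qInt q (m+1) < qInt q (m+1+1) := by
    rw [qInt_succ q (m+1)]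
    have : 0 < q ^ (m+1) := by positivity
    linarith
  have := inv_strictAnti₀ h1 h2
  linarith

lemma b_vn (q : ℝ) (hq : 0 < q) (m k : ℕ) :
    b q m k * (q / qInt q (m+1)) ^ k = ∏ i ∈ range k, (vn q m - vn q i) := by
  unfold b vn
  rw [← card_range k, ← prod_const, card_range, ← prod_mul_distrib]
  refine prod_congr rfl fun i _ => ?_
  have h1 := (qInt_pos q hq m).ne'
  have h2 := (qInt_pos q hq i).ne'
  field_simp
  rw [qInt_succ' q m, qInt_succ' q i]
  ring

lemma qAbel_expand (q α : ℝ) (hq : 0 < q) (hα : α < 0) (m : ℕ) (x : ℝ) :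
    qAbel q α (m+1) x = (-α * qInt q (m+1)) ^ m *
      ∑ k ∈ range (m+1), (∏ i ∈ range k, (vn q m - vn q i)) * ((-α)⁻¹ ^ k * x ^ (k+1)) := by
  have hy : -α * qInt q (m+1) ≠ 0 := (mul_pos (by linarith) (qInt_pos q hq m)).ne'
  have hα' : -α ≠ 0 := by linarith
  have h1 := (qInt_pos q hq m).ne'
  have e : ∏ j ∈ Finset.Icc 1 m, (x * q ^ j - α * qInt q (m+1))
      = (-α * qInt q (m+1)) ^ m *
        ∏ j ∈ Finset.Icc 1 m, (x / (-α * qInt q (m+1)) * q ^ j + 1) := by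
    have : (-α * qInt q (m+1)) ^ m = ∏ j ∈ Finset.Icc 1 m, (-α * qInt q (m+1)) := by simp
    rw [this, ← prod_mul_distrib]
    refine prod_congr rfl fun j _ => ?_
    rw [mul_add, ← mul_assoc, mul_div_cancel₀ _ hy]
    ring
  unfold qAbel
  rw [if_neg (by omega), Nat.add_sub_cancel, e, qbinomial q hq, mul_left_comm, mul_sum]
  congr 1
  refine sum_congr rfl fun k _ => ?_
  rw [← b_vn q hq]
  rw [show q * (x / (-α * qInt q (m+1))) = (q / qInt q (m+1)) * (-α)⁻¹ * x by
    rw [div_eq_mul_inv, mul_inv, div_eq_mul_inv]; ring]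
  rw [mul_pow, mul_pow]
  ring

lemma STP.scale {R : ℕ → ℕ → ℝ} (h : STP R) (d : ℕ → ℝ) (hd : ∀ m, 0 < d m) :
    STP (fun m => d m • R m) :=
  h.stage _ d (fun _ => 0) hd (fun _ => le_rfl) rfl (fun m => by simp)

/-- `T` is a linear functional-valued sequence: if moments against `x ^ m` are STP then
so are moments against the `q`-Abel polynomials. -/
lemma STP.abel (q α : ℝ) (hq : 0 < q) (hα : α ≤ 0) (w : ℕ → ℝ → ℝ) (hw : ∀ j, Continuous (w j))
    (h : STP (fun m j => ∫ x in (0:ℝ)..1, x ^ m * w j x)) :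
    STP (fun m j => ∫ x in (0:ℝ)..1, qAbel q α m x * w j x) := by
  rcases hα.lt_or_eq with hα | hα
  · have h1 := h.scale (fun m => (-α)⁻¹ ^ (m-1)) (fun m => by
      have : 0 < -α := by linarith
      positivity)
    have h2 := h1.newton (vn q) (vn_mono q hq)
    have h3 := h2.scale (fun m => (-α * qInt q m) ^ (m-1)) (fun m => by
      rcases m with _ | m
      · simp
      · have := qInt_pos q hq m
        have : 0 < -α := by linarith
        positivity)
    convert h3 using 1
    ext m j
    rcases m with _ | m
    · simp [qAbel]
    · simp only [qAbel_expand q α hq hα, Nat.add_sub_cancel, Pi.smul_apply, Finset.sum_apply,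
        smul_eq_mul]
      simp only [mul_assoc, intervalIntegral.integral_const_mul, sum_mul]
      rw [intervalIntegral.integral_finsetSum]
      · simp only [intervalIntegral.integral_const_mul]
      · intro k _
        apply Continuous.intervalIntegrable
        have := hw j
        fun_prop
  · subst hα
    have h1 := h.scale (fun m => ∏ j ∈ Finset.Icc 1 (m-1), q ^ j) (fun m => by positivity)
    convert h1 using 1
    ext m j
    rw [Pi.smul_apply, smul_eq_mul, ← intervalIntegral.integral_const_mul]
    congr 1
    ext x
    rcases m with _ | m
    · simp [qAbel]
    · simp only [qAbel, zero_mul, sub_zero, Nat.add_sub_cancel, prod_mul_distrib, prod_const]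
      simp
      ring

lemma hilbert : STP (fun m j => ∫ x in (0:ℝ)..1, x ^ m * x ^ j) := by
  intro k f g hf hg
  have := cauchy_pos k (fun i => (f i : ℝ)) (fun i => (g i : ℝ) + 1)
    (fun a b hab => by have := hf hab; simpa using this)
    (fun a b hab => by have := hg hab; simpa using this)
    (fun i j => by positivity)
  convert this using 4 with i j
  simp only [← pow_add, integral_pow]
  push_cast
  simp [add_assoc]

lemma qAbel_continuous (q α : ℝ) (m : ℕ) : Continuous (qAbel q α m) := by
  unfold qAbel
  split_ifs
  · fun_prop
  · fun_prop

lemma gram (q α : ℝ) (hq : 0 < q) (hα : α ≤ 0) :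
    STP (fun i j => ∫ x in (0:ℝ)..1, qAbel q α i x * qAbel q α j x) := by
  have h1 := hilbert.abel q α hq hα (fun j x => x ^ j) (fun j => by fun_prop)
  have h2 := h1.transpose
  simp only [mul_comm (qAbel q α _ _)] at h2
  exact h2.abel q α hq hα (fun j => qAbel q α j) (fun j => qAbel_continuous q α j)

end QAbelAux

theorem qAbel_gramian_strictTotallyPos (q α : ℝ) (hq : 0 < q) (hα : α ≤ 0) (n : ℕ) :
    IsStrictTotallyPos
      (Matrix.of fun i j : Fin (n + 1) =>
        ∫ x in (0 : ℝ)..1, qAbel q α (i : ℕ) x * qAbel q α (j : ℕ) x) := by 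
  intro k f g hf hg
  exact QAbelAux.gram q α hq hα k (fun i => (f i : ℕ)) (fun j => (g j : ℕ)) hf hg
end
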